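/- arXiv:1806.10204 — 7 statements merged into one kernel-verified Lean document; each statement's English description precedes it below -/
import Mathlib

section
/- In any associative triple system A, the special commutator satisfies the degree 5 identity: for all v, w, x, y, z in A, T_{x,z}(v,w,y) + T_{x,z}(w,y,v) + T_{x,z}(y,v,w) = 0, where T_{x,z}(v,w,y) = [[v,w,x],y,z] − [v,w,[x,y,z]]. -/
/-- The special commutator `[x,y,z] = xyz - yxz` associated to a trilinear operation. -/
def specialCom {F : Type*} [Field F] {A : Type*} [AddCommGroup A] [Module F A]
    (m : A →ₗ[F] A →ₗ[F] A →ₗ[F] A) (x y z : A) : A :=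
  m x y z - m y x z

/-- The operator `T_{x,z}(v,w,y) = [[v,w,x],y,z] - [v,w,[x,y,z]]`. -/
def Tcom {F : Type*} [Field F] {A : Type*} [AddCommGroup A] [Module F A]
    (m : A →ₗ[F] A →ₗ[F] A →ₗ[F] A) (x z v w y : A) : A :=
  specialCom m (specialCom m v w x) y z - specialCom m v w (specialCom m x y z)

/-- In any associative triple system, the special commutator satisfies the
degree 5 identity `T_{x,z}(v,w,y) + T_{x,z}(w,y,v) + T_{x,z}(y,v,w) = 0`. -/
theorem special_commutator_degree5 (F : Type*) [Field F] [CharZero F]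
    (A : Type*) [AddCommGroup A] [Module F A]
    (m : A →ₗ[F] A →ₗ[F] A →ₗ[F] A)
    (assoc1 : ∀ v w x y z : A, m (m v w x) y z = m v (m w x y) z)
    (assoc2 : ∀ v w x y z : A, m v (m w x y) z = m v w (m x y z)) :
    ∀ v w x y z : A,
      Tcom m x z v w y + Tcom m x z w y v + Tcom m x z y v w = 0 := by
  intro v w x y z
  simp only [Tcom, specialCom, map_sub, LinearMap.sub_apply, assoc1, assoc2]
  abel
end

section
/- In any associative triple system A, the operator R_{y,z}(u) = ⟨u,y,z⟩ acts as a derivation of the special translator: for all v, w, x, y, z in A, R_{y,z}(⟨v,w,x⟩) = ⟨R_{y,z}(v), w, x⟩ + ⟨v, R_{y,z}(w), x⟩ + ⟨v, w, R_{y,z}(x)⟩. -/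
/-- The special translator `⟨x,y,z⟩ = xyz - yzx` associated to a trilinear operation. -/
def specialTr {F : Type*} [Field F] {A : Type*} [AddCommGroup A] [Module F A]
    (m : A →ₗ[F] A →ₗ[F] A →ₗ[F] A) (x y z : A) : A :=
  m x y z - m y z x

/-- The operator `R_{y,z}(u) = ⟨u,y,z⟩`. -/
def Rop {F : Type*} [Field F] {A : Type*} [AddCommGroup A] [Module F A]
    (m : A →ₗ[F] A →ₗ[F] A →ₗ[F] A) (y z u : A) : A :=
  specialTr m u y z

/-- In any associative triple system, the operator `R_{y,z}` acts as a derivation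
of the special translator. -/
theorem special_translator_degree5 (F : Type*) [Field F] [CharZero F]
    (A : Type*) [AddCommGroup A] [Module F A]
    (m : A →ₗ[F] A →ₗ[F] A →ₗ[F] A)
    (assoc1 : ∀ v w x y z : A, m (m v w x) y z = m v (m w x y) z)
    (assoc2 : ∀ v w x y z : A, m v (m w x y) z = m v w (m x y z)) :
    ∀ v w x y z : A,
      Rop m y z (specialTr m v w x) =
        specialTr m (Rop m y z v) w x + specialTr m v (Rop m y z w) x +
          specialTr m v w (Rop m y z x) := by
  intro v w x y z
  simp only [Rop, specialTr, map_sub, LinearMap.sub_apply, assoc1, assoc2]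
  abel
end

section
/- In any associative triple system A, the special commutator and special translator satisfy the mixed degree 5 identity: for all v, w, x, y, z in A, [[v,w,x],y,z] + [[x,v,y],w,z] − [⟨v,w,x⟩,y,z] + [⟨v,y,w⟩,x,z] − [⟨x,y,w⟩,v,z] = 0. -/
/-- In any associative triple system, the special commutator and translator satisfy
the mixed degree 5 identity
`[[v,w,x],y,z] + [[x,v,y],w,z] − [⟨v,w,x⟩,y,z] + [⟨v,y,w⟩,x,z] − [⟨x,y,w⟩,v,z] = 0`. -/
theorem mixed_degree5_identity_1 (F : Type*) [Field F] [CharZero F]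
    (A : Type*) [AddCommGroup A] [Module F A]
    (m : A →ₗ[F] A →ₗ[F] A →ₗ[F] A)
    (assoc1 : ∀ v w x y z : A, m (m v w x) y z = m v (m w x y) z)
    (assoc2 : ∀ v w x y z : A, m v (m w x y) z = m v w (m x y z)) :
    ∀ v w x y z : A,
      specialCom m (specialCom m v w x) y z
      + specialCom m (specialCom m x v y) w z
      - specialCom m (specialTr m v w x) y z
      + specialCom m (specialTr m v y w) x z
      - specialCom m (specialTr m x y w) v z = 0 := by
  intro v w x y z
  simp only [specialCom, specialTr, map_sub, LinearMap.sub_apply, assoc1, assoc2]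
  abel
end

section
/- In any associative triple system A, the special commutator and special translator satisfy the mixed degree 5 identity: for all v, w, x, y, z in A, [[v,w,x],y,z] − [[v,y,w],x,z] + ⟨[w,v,z],x,y⟩ + [⟨v,y,w⟩,x,z] + [v,w,⟨z,x,y⟩] = 0. -/
/-- In any associative triple system, the special commutator and translator satisfy
the mixed degree 5 identity
`[[v,w,x],y,z] − [[v,y,w],x,z] + ⟨[w,v,z],x,y⟩ + [⟨v,y,w⟩,x,z] + [v,w,⟨z,x,y⟩] = 0`. -/
theorem mixed_degree5_identity_2 (F : Type*) [Field F] [CharZero F]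
    (A : Type*) [AddCommGroup A] [Module F A]
    (m : A →ₗ[F] A →ₗ[F] A →ₗ[F] A)
    (assoc1 : ∀ v w x y z : A, m (m v w x) y z = m v (m w x y) z)
    (assoc2 : ∀ v w x y z : A, m v (m w x y) z = m v w (m x y z)) :
    ∀ v w x y z : A,
      specialCom m (specialCom m v w x) y z
      - specialCom m (specialCom m v y w) x z
      + specialTr m (specialCom m w v z) x y
      + specialCom m (specialTr m v y w) x z
      + specialCom m v w (specialTr m z x y) = 0 := by
  intro v w x y z
  simp only [specialCom, specialTr, map_sub, LinearMap.sub_apply, assoc1, assoc2]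
  abel
end

section
/- In any associative triple system A, the special commutator and special translator satisfy the 13-term mixed degree 5 identity: for all v, w, x, y, z in A, [[v,w,x],y,z] + [[v,w,z],x,y] − [[x,w,y],v,z] − [[z,w,y],x,v] + ⟨[w,v,z],x,y⟩ + ⟨[x,w,z],y,v⟩ + ⟨[z,w,y],x,v⟩ + [⟨w,v,x⟩,y,z] + [⟨w,v,z⟩,x,y] − [⟨w,y,v⟩,x,z] − ⟨⟨w,v,z⟩,x,y⟩ + ⟨⟨w,y,v⟩,x,z⟩ + ⟨w,x,⟨z,y,v⟩⟩ = 0. -/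
/-- In any associative triple system, the special commutator and translator satisfy
the 13-term mixed degree 5 identity. -/
theorem mixed_degree5_identity_3 (F : Type*) [Field F] [CharZero F]
    (A : Type*) [AddCommGroup A] [Module F A]
    (m : A →ₗ[F] A →ₗ[F] A →ₗ[F] A)
    (assoc1 : ∀ v w x y z : A, m (m v w x) y z = m v (m w x y) z)
    (assoc2 : ∀ v w x y z : A, m v (m w x y) z = m v w (m x y z)) :
    ∀ v w x y z : A,
      specialCom m (specialCom m v w x) y z
      + specialCom m (specialCom m v w z) x y
      - specialCom m (specialCom m x w y) v z
      - specialCom m (specialCom m z w y) x v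
      + specialTr m (specialCom m w v z) x y
      + specialTr m (specialCom m x w z) y v
      + specialTr m (specialCom m z w y) x v
      + specialCom m (specialTr m w v x) y z
      + specialCom m (specialTr m w v z) x y
      - specialCom m (specialTr m w y v) x z
      - specialTr m (specialTr m w v z) x y
      + specialTr m (specialTr m w y v) x z
      + specialTr m w x (specialTr m z y v) = 0 := by
  intro v w x y z
  simp only [specialCom, specialTr, map_sub, LinearMap.sub_apply, assoc1, assoc2]
  abel
end

section
/- In any associative triple system A, the operator T_{y,z}(u) = {u,y,z} + {u,z,y} acts as a derivation of the weakly anticommutative operation: for all v, w, x, y, z in A, T_{y,z}({v,w,x}) = {T_{y,z}(v), w, x} + {v, T_{y,z}(w), x} + {v, w, T_{y,z}(x)}. -/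
/-- The weakly anticommutative operation `{x,y,z} = xyz + xzy - 2zyx`
associated to a trilinear operation. -/
def weakAnti {F : Type*} [Field F] {A : Type*} [AddCommGroup A] [Module F A]
    (m : A →ₗ[F] A →ₗ[F] A →ₗ[F] A) (x y z : A) : A :=
  m x y z + m x z y - (2 : F) • m z y x

/-- The operator `T_{y,z}(u) = {u,y,z} + {u,z,y}`. -/
def Twa {F : Type*} [Field F] {A : Type*} [AddCommGroup A] [Module F A]
    (m : A →ₗ[F] A →ₗ[F] A →ₗ[F] A) (y z u : A) : A :=
  weakAnti m u y z + weakAnti m u z y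

/-- In any associative triple system, the operator `T_{y,z}` acts as a derivation of
the weakly anticommutative operation. -/
theorem weakAnti_derivation (F : Type*) [Field F] [CharZero F]
    (A : Type*) [AddCommGroup A] [Module F A]
    (m : A →ₗ[F] A →ₗ[F] A →ₗ[F] A)
    (assoc1 : ∀ v w x y z : A, m (m v w x) y z = m v (m w x y) z)
    (assoc2 : ∀ v w x y z : A, m v (m w x y) z = m v w (m x y z)) :
    ∀ v w x y z : A,
      Twa m y z (weakAnti m v w x) =
        weakAnti m (Twa m y z v) w x + weakAnti m v (Twa m y z w) x +
          weakAnti m v w (Twa m y z x) := by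
  intro v w x y z
  simp only [Twa, weakAnti, map_add, map_sub, map_smul, LinearMap.add_apply,
    LinearMap.sub_apply, LinearMap.smul_apply, assoc1, assoc2]
  module
end

section
/- The expansion map X₁ : ℚ¹² → ℚ⁶ has rank 5, and its kernel is the 7-dimensional subspace of ℚ¹² spanned by the coefficient vectors of the polynomials obtained by applying all permutations σ of {x,y,z} to the three comtrans relations [x,y,z] + [y,x,z], ⟨x,y,z⟩ + ⟨y,z,x⟩ + ⟨z,x,y⟩, and [x,y,z] + [z,y,x] − ⟨x,y,z⟩ − ⟨z,y,x⟩. -/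
/-- The matrix of the expansion map `X₁ : ℚ¹² → ℚ⁶` in degree 3.
Coordinates of `ℚ⁶` are indexed by the associative monomials
`xyz, xzy, yxz, yzx, zxy, zyx` (lex order); coordinates of `ℚ¹²` are indexed by
the comtrans monomials `[x,y,z], [x,z,y], [y,x,z], [y,z,x], [z,x,y], [z,y,x],
⟨x,y,z⟩, ⟨x,z,y⟩, ⟨y,x,z⟩, ⟨y,z,x⟩, ⟨z,x,y⟩, ⟨z,y,x⟩`.
The column indexed by `[a,b,c]` is the coefficient vector of `abc − bac` and the
column indexed by `⟨a,b,c⟩` is the coefficient vector of `abc − bca`. -/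
noncomputable def expansionX1 : Matrix (Fin 6) (Fin 12) ℚ :=
  !![ 1, 0,-1, 0, 0, 0,  1, 0, 0, 0,-1, 0;
      0, 1, 0, 0,-1, 0,  0, 1,-1, 0, 0, 0;
     -1, 0, 1, 0, 0, 0,  0, 0, 1, 0, 0,-1;
      0, 0, 0, 1, 0,-1, -1, 0, 0, 1, 0, 0;
      0,-1, 0, 0, 1, 0,  0, 0, 0,-1, 1, 0;
      0, 0, 0,-1, 0, 1,  0,-1, 0, 0, 0, 1]

/-- The coefficient vectors (rows) of the polynomials obtained by applying the six
permutations σ of {x,y,z} (in lex order) to the three comtrans relations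
`[x,y,z] + [y,x,z]` (rows 1–6), `⟨x,y,z⟩ + ⟨y,z,x⟩ + ⟨z,x,y⟩` (rows 7–12), and
`[x,y,z] + [z,y,x] − ⟨x,y,z⟩ − ⟨z,y,x⟩` (rows 13–18), with respect to the ordered
basis `[x,y,z], [x,z,y], [y,x,z], [y,z,x], [z,x,y], [z,y,x], ⟨x,y,z⟩, ⟨x,z,y⟩,
⟨y,x,z⟩, ⟨y,z,x⟩, ⟨z,x,y⟩, ⟨z,y,x⟩` of ℚ¹². -/
noncomputable def comtransRelVectors : Matrix (Fin 18) (Fin 12) ℚ :=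
  !![ 1, 0, 1, 0, 0, 0,  0, 0, 0, 0, 0, 0;
      0, 1, 0, 0, 1, 0,  0, 0, 0, 0, 0, 0;
      1, 0, 1, 0, 0, 0,  0, 0, 0, 0, 0, 0;
      0, 0, 0, 1, 0, 1,  0, 0, 0, 0, 0, 0;
      0, 1, 0, 0, 1, 0,  0, 0, 0, 0, 0, 0;
      0, 0, 0, 1, 0, 1,  0, 0, 0, 0, 0, 0;
      0, 0, 0, 0, 0, 0,  1, 0, 0, 1, 1, 0;
      0, 0, 0, 0, 0, 0,  0, 1, 1, 0, 0, 1;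
      0, 0, 0, 0, 0, 0,  0, 1, 1, 0, 0, 1;
      0, 0, 0, 0, 0, 0,  1, 0, 0, 1, 1, 0;
      0, 0, 0, 0, 0, 0,  1, 0, 0, 1, 1, 0;
      0, 0, 0, 0, 0, 0,  0, 1, 1, 0, 0, 1;
      1, 0, 0, 0, 0, 1, -1, 0, 0, 0, 0,-1;
      0, 1, 0, 1, 0, 0,  0,-1, 0,-1, 0, 0;
      0, 0, 1, 0, 1, 0,  0, 0,-1, 0,-1, 0;
      0, 1, 0, 1, 0, 0,  0,-1, 0,-1, 0, 0;
      0, 0, 1, 0, 1, 0,  0, 0,-1, 0,-1, 0;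
      1, 0, 0, 0, 0, 1, -1, 0, 0, 0, 0,-1]

theorem ker_le_aux (v : Fin 12 → ℚ) (hv : expansionX1.mulVec v = 0) :
    v = ∑ j : Fin 7, (![v 2, v 4, v 5 - v 0 + v 2, v 10, v 8, v 0 - v 2, v 1 - v 4] j) •
      comtransRelVectors (![0, 1, 3, 6, 7, 12, 13] j) := by
  have h0 := congrFun hv 0
  have h1 := congrFun hv 1
  have h2 := congrFun hv 2
  have h3 := congrFun hv 3
  have h4 := congrFun hv 4
  have h5 := congrFun hv 5
  simp [expansionX1, Matrix.mulVec, dotProduct, Fin.sum_univ_succ] at h0 h1 h2 h3 h4 h5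
  ext k
  fin_cases k <;> simp [comtransRelVectors, Fin.sum_univ_succ] <;> linarith

theorem rel_mem_aux (i : Fin 18) : expansionX1.mulVec (comtransRelVectors i) = 0 := by
  ext k
  fin_cases i <;> fin_cases k <;>
    simp [expansionX1, comtransRelVectors, Matrix.mulVec, dotProduct, Fin.sum_univ_succ]

theorem indep_aux : LinearIndependent ℚ
    (fun j : Fin 7 => comtransRelVectors (![0, 1, 3, 6, 7, 12, 13] j)) := by
  rw [Fintype.linearIndependent_iff]
  intro g hg
  have h0 := congrFun hg 0
  have h1 := congrFun hg 1
  have h2 := congrFun hg 2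
  have h4 := congrFun hg 4
  have h5 := congrFun hg 5
  have h8 := congrFun hg 8
  have h10 := congrFun hg 10
  simp [comtransRelVectors, Fin.sum_univ_succ] at h0 h1 h2 h4 h5 h8 h10
  intro i
  fin_cases i <;> simp <;> linarith

/-- The expansion map `X₁ : ℚ¹² → ℚ⁶` has rank 5, and its kernel is the
7-dimensional subspace spanned by the coefficient vectors of all permutations of
the three defining comtrans relations. -/
theorem expansion_degree3_kernel :
    expansionX1.rank = 5 ∧
    LinearMap.ker expansionX1.mulVecLin =
      Submodule.span ℚ (Set.range fun i => comtransRelVectors i) ∧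
    Module.finrank ℚ
      (Submodule.span ℚ (Set.range fun i => comtransRelVectors i)) = 7 := by
  have hle : Submodule.span ℚ (Set.range fun i => comtransRelVectors i) ≤
      LinearMap.ker expansionX1.mulVecLin := by
    rw [Submodule.span_le]
    rintro _ ⟨i, rfl⟩
    exact rel_mem_aux i
  have hge : LinearMap.ker expansionX1.mulVecLin ≤ Submodule.span ℚ
      (Set.range fun j : Fin 7 => comtransRelVectors (![0, 1, 3, 6, 7, 12, 13] j)) := by
    intro v hv
    rw [ker_le_aux v hv]
    exact Submodule.sum_mem _ fun j _ =>
      Submodule.smul_mem _ _ (Submodule.subset_span ⟨j, rfl⟩)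
  have hsub : Submodule.span ℚ
      (Set.range fun j : Fin 7 => comtransRelVectors (![0, 1, 3, 6, 7, 12, 13] j)) ≤
      Submodule.span ℚ (Set.range fun i => comtransRelVectors i) := by
    apply Submodule.span_mono
    rintro _ ⟨j, rfl⟩
    exact ⟨_, rfl⟩
  have hker := le_antisymm (hge.trans hsub) hle
  have h7 : Module.finrank ℚ
      (Submodule.span ℚ (Set.range fun i => comtransRelVectors i)) = 7 := by
    rw [← le_antisymm hsub (hle.trans hge), finrank_span_eq_card indep_aux]
    simp
  refine ⟨?_, hker, h7⟩
  have hr := LinearMap.finrank_range_add_finrank_ker expansionX1.mulVecLin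
  rw [hker, h7, Module.finrank_fin_fun] at hr
  unfold Matrix.rank
  omega
end
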